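/- If 0 < p ≤ λ·α/T, then the follower's maximal utility over t ≥ 0 equals U(t*) = λ − p·T/α − (p·T/α)·ln(λ·α/(T·p)) where t* = (T/α)·ln(λ·α/(T·p)), and this value is nonnegative. -/

import Mathlib

open Real

/-- For λ > 0, T > 0, α > 0 and `0 < p ≤ λ·α/T`, with
`t* = (T/α)·ln(λ·α/(T·p))`, the maximal utility of
`U t = λ·(1 − exp(−α·t/T)) − p·t` over `t ≥ 0` equals
`λ − p·T/α − (p·T/α)·ln(λ·α/(T·p))`, and this value is nonnegative. -/
theorem max_utility_value
    (lam T alpha p : ℝ) (hlam : 0 < lam) (hT : 0 < T) (halpha : 0 < alpha)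
    (hp : 0 < p) (hp' : p ≤ lam * alpha / T)
    (U : ℝ → ℝ) (hU : U = fun t => lam * (1 - Real.exp (-alpha * t / T)) - p * t)
    (tstar : ℝ) (htstar : tstar = (T / alpha) * Real.log (lam * alpha / (T * p))) :
    U tstar = lam - p * T / alpha - (p * T / alpha) * Real.log (lam * alpha / (T * p)) ∧
    (∀ t : ℝ, 0 ≤ t → U t ≤ U tstar) ∧
    0 ≤ lam - p * T / alpha - (p * T / alpha) * Real.log (lam * alpha / (T * p)) := by
  have hr : 0 < lam * alpha / (T * p) := by positivity
  have hval : U tstar =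
      lam - p * T / alpha - (p * T / alpha) * Real.log (lam * alpha / (T * p)) := by
    have harg : -alpha * tstar / T = -Real.log (lam * alpha / (T * p)) := by
      rw [htstar]
      field_simp
    simp only [hU]
    rw [harg, Real.exp_neg, Real.exp_log hr, htstar]
    field_simp
  have hmax : ∀ t : ℝ, 0 ≤ t → U t ≤ U tstar := by
    intro t _
    rw [hval]
    simp only [hU]
    have hexp : lam * Real.exp (-alpha * t / T) = p * T / alpha *
        Real.exp (Real.log (lam * alpha / (T * p)) + -alpha * t / T) := by
      rw [Real.exp_add, Real.exp_log hr]
      field_simp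
    have htangent := mul_le_mul_of_nonneg_left
      (Real.add_one_le_exp (Real.log (lam * alpha / (T * p)) + -alpha * t / T))
      (show 0 ≤ p * T / alpha by positivity)
    have hlin : p * T / alpha * (-alpha * t / T) = -(p * t) := by
      field_simp
    linarith
  refine ⟨hval, hmax, ?_⟩
  have hzero : U 0 = 0 := by simp [hU]
  rw [← hval, ← hzero]
  exact hmax 0 le_rfl
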